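/- arXiv:2309.09407 — 2 statements merged into one kernel-verified Lean document; each statement's English description precedes it below -/
import Mathlib

section
/- For all integers p ≥ 1, n ≥ 1, and 0 ≤ k ≤ n, the number A(p,n,k) of p-tuples of pairwise commuting permutations of [n] whose generated subgroup acts with exactly k orbits satisfies A(p,n,k) = (n!/k!) · Σ_{n_1,...,n_k ≥ 1, n_1+⋯+n_k = n} Π_{i=1}^{k} B(p,n_i)/n_i. -/
/-- `A p n k` is the number of `p`-tuples of pairwise commuting permutations of
`{1,…,n}` whose generated subgroup acts on `{1,…,n}` with exactly `k` orbits. -/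
noncomputable def A (p n k : ℕ) : ℕ :=
  Nat.card {σ : Fin p → Equiv.Perm (Fin n) //
    (∀ i j, Commute (σ i) (σ j)) ∧
    Nat.card (MulAction.orbitRel.Quotient
      (Subgroup.closure (Set.range σ)) (Fin n)) = k}

/-- `B p n = Σ_{s₁ | s₂ | ⋯ | s_{p-1} | n} s₁⋯s_{p-1}`, the sum over `(p-1)`-tuples of
positive integers forming a divisibility chain ending at `n`, of their product. -/
def B (p n : ℕ) : ℕ :=
  ∑ s ∈ Finset.filter
      (fun s : Fin (p - 1) → ℕ =>
        ∀ i : Fin (p - 1),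
          s i ∣ if h : i.val + 1 < p - 1 then s ⟨i.val + 1, h⟩ else n)
      (Fintype.piFinset fun _ => n.divisors),
    ∏ i, s i

theorem B_one (n : ℕ) : B 1 n = 1 := by
  simp [B]

theorem chain_dvd {q x : ℕ} (t : Fin q → ℕ)
    (h : ∀ i : Fin q, t i ∣ if h : i.val + 1 < q then t ⟨i.val + 1, h⟩ else x) :
    ∀ i, t i ∣ x := by
  have key : ∀ m, ∀ i : Fin q, q - i.val ≤ m → t i ∣ x := by
    intro m
    induction m with
    | zero => intro i hi; have := i.2; omega
    | succ m ih =>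
      intro i hi
      have h1 := h i
      by_cases hq : i.val + 1 < q
      · rw [dif_pos hq] at h1
        exact h1.trans (ih ⟨i.val + 1, hq⟩ (by simp; omega))
      · rwa [dif_neg hq] at h1
  exact fun i => key _ i le_rfl

theorem chain_snoc {q x n : ℕ} (t : Fin q → ℕ) :
    (∀ i : Fin (q+1), (Fin.snoc t x : Fin (q+1) → ℕ) i ∣
      if h : i.val + 1 < q + 1 then (Fin.snoc t x : Fin (q+1) → ℕ) ⟨i.val + 1, h⟩ else n) ↔
    (∀ i : Fin q, t i ∣ if h : i.val + 1 < q then t ⟨i.val + 1, h⟩ else x) ∧ x ∣ n := by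
  rw [Fin.forall_fin_succ']
  apply and_congr
  · apply forall_congr'
    intro i
    have h1 : i.val + 1 < q + 1 := by omega
    rw [Fin.snoc_castSucc, dif_pos (by simpa using h1)]
    by_cases hq : i.val + 1 < q
    · rw [dif_pos hq]
      have : (⟨(i.castSucc).val + 1, by simpa using h1⟩ : Fin (q+1)) = Fin.castSucc ⟨i.val+1, hq⟩ := rfl
      rw [this, Fin.snoc_castSucc]
    · rw [dif_neg hq]
      have : (⟨(i.castSucc).val + 1, by simpa using h1⟩ : Fin (q+1)) = Fin.last q := by
        ext; simp; omega
      rw [this, Fin.snoc_last]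
  · simp

theorem B_succ (p n : ℕ) (hn : n ≠ 0) : B (p + 2) n = ∑ s ∈ n.divisors, s * B (p + 1) s := by
  unfold B
  simp only [Finset.mul_sum]
  rw [Finset.sum_sigma']
  symm
  refine Finset.sum_bij' (fun a _ => (Fin.snoc a.2 a.1 : Fin (p+1) → ℕ))
    (fun s _ => ⟨s (Fin.last p), Fin.init s⟩) ?_ ?_ ?_ ?_ ?_
  · rintro ⟨x, t⟩ h
    simp only [Finset.mem_sigma, Finset.mem_filter, Fintype.mem_piFinset, Nat.mem_divisors] at h ⊢
    obtain ⟨h1, h2, h3⟩ := h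
    refine ⟨?_, (chain_snoc t).2 ⟨h3, h1.1⟩⟩
    intro a
    refine ⟨?_, hn⟩
    refine Fin.lastCases ?_ (fun i => ?_) a
    · simpa using h1.1
    · rw [Fin.snoc_castSucc]; exact (h2 i).1.trans h1.1
  · intro s h
    simp only [Finset.mem_sigma, Finset.mem_filter, Fintype.mem_piFinset, Nat.mem_divisors] at h ⊢
    obtain ⟨h1, h2⟩ := h
    have h3 := (chain_snoc (q := p) (x := s (Fin.last p)) (n := n) (Fin.init s)).1
      (by rw [Fin.snoc_init_self]; exact h2)
    have h0 : s (Fin.last p) ≠ 0 := fun h => hn (by simpa [h] using (h1 (Fin.last p)).1)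
    exact ⟨h1 _, fun a => ⟨chain_dvd _ h3.1 a, h0⟩, h3.1⟩
  · rintro ⟨x, t⟩ h
    simp
  · intro s h
    simp
  · rintro ⟨x, t⟩ h
    have := Fin.prod_snoc x t
    rw [mul_comm]; exact this.symm

section lattice
variable {G : Type*} [AddCommGroup G]

theorem index_prod_eq (L : AddSubgroup (G × ℤ)) :
    L.index = (L.comap (AddMonoidHom.inl G ℤ)).index * (L.map (AddMonoidHom.snd G ℤ)).index := by
  have hk : (AddMonoidHom.snd G ℤ).ker = (AddMonoidHom.inl G ℤ).range := by
    ext ⟨a, b⟩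
    rw [AddMonoidHom.mem_ker]
    simp [AddMonoidHom.mem_range, Prod.ext_iff, eq_comm]
  have hr : (AddMonoidHom.snd G ℤ).range = ⊤ :=
    AddMonoidHom.range_eq_top.2 (fun x => ⟨(0, x), rfl⟩)
  rw [AddSubgroup.index_map, hr, AddSubgroup.index_top, mul_one, hk, AddSubgroup.index_comap,
    ← AddSubgroup.relIndex_sup_right, sup_comm, AddSubgroup.relIndex_mul_index le_sup_left]

/-- The lattice of pairs `(g, d t)` with `g = t v` modulo `M`. -/
def latt (M : AddSubgroup G) (d : ℕ) (v : G ⧸ M) : AddSubgroup (G × ℤ) where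
  carrier := {x | ∃ t : ℤ, x.2 = d * t ∧ (QuotientAddGroup.mk x.1 : G ⧸ M) = t • v}
  zero_mem' := ⟨0, by simp, by simp⟩
  add_mem' := by
    rintro ⟨a, x⟩ ⟨b, y⟩ ⟨t, h1, h2⟩ ⟨u, h3, h4⟩
    refine ⟨t + u, ?_, ?_⟩
    · simp only [Prod.mk_add_mk] at *; rw [h1, h3]; ring
    · simp only [Prod.mk_add_mk, QuotientAddGroup.mk_add] at *; rw [h2, h4, add_smul]
  neg_mem' := by
    rintro ⟨a, x⟩ ⟨t, h1, h2⟩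
    refine ⟨-t, ?_, ?_⟩
    · simp only [Prod.neg_mk] at *; rw [h1]; ring
    · simp only [Prod.neg_mk, QuotientAddGroup.mk_neg] at *; rw [h2, neg_smul]

theorem mem_latt (M : AddSubgroup G) (d : ℕ) (v : G ⧸ M) (x : G × ℤ) :
    x ∈ latt M d v ↔ ∃ t : ℤ, x.2 = d * t ∧ (QuotientAddGroup.mk x.1 : G ⧸ M) = t • v := Iff.rfl

theorem latt_comap (M : AddSubgroup G) (d : ℕ) (hd : d ≠ 0) (v : G ⧸ M) :
    (latt M d v).comap (AddMonoidHom.inl G ℤ) = M := by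
  ext g
  simp only [AddSubgroup.mem_comap, mem_latt, AddMonoidHom.inl_apply]
  constructor
  · rintro ⟨t, h1, h2⟩
    have : t = 0 := by
      rcases mul_eq_zero.1 h1.symm with h | h
      · exact absurd (by exact_mod_cast h) hd
      · exact h
    rw [this, zero_smul] at h2
    exact (QuotientAddGroup.eq_zero_iff g).1 h2
  · intro h
    exact ⟨0, by simp, by rw [zero_smul]; exact (QuotientAddGroup.eq_zero_iff g).2 h⟩

theorem latt_map (M : AddSubgroup G) (d : ℕ) (v : G ⧸ M) :
    (latt M d v).map (AddMonoidHom.snd G ℤ) = AddSubgroup.zmultiples (d : ℤ) := by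
  ext z
  simp only [AddSubgroup.mem_map, mem_latt, AddSubgroup.mem_zmultiples_iff]
  constructor
  · rintro ⟨x, ⟨t, h1, h2⟩, rfl⟩
    exact ⟨t, by simp [h1, mul_comm]⟩
  · rintro ⟨t, rfl⟩
    obtain ⟨g, hg⟩ := QuotientAddGroup.mk_surjective (t • v)
    exact ⟨(g, t • (d : ℤ)), ⟨t, by simp [mul_comm], hg⟩, rfl⟩

theorem latt_index (M : AddSubgroup G) (d : ℕ) (hd : d ≠ 0) (v : G ⧸ M) :
    (latt M d v).index = M.index * d := by
  rw [index_prod_eq, latt_comap M d hd, latt_map, Int.index_zmultiples, Int.natAbs_natCast]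

theorem latt_surj (L : AddSubgroup (G × ℤ)) (_h : L.index ≠ 0) :
    ∃ v, L = latt (L.comap (AddMonoidHom.inl G ℤ)) (L.map (AddMonoidHom.snd G ℤ)).index v := by
  set d := (L.map (AddMonoidHom.snd G ℤ)).index with hd
  have hmap : L.map (AddMonoidHom.snd G ℤ) = AddSubgroup.zmultiples (d : ℤ) := by
    obtain ⟨a, ha⟩ := Int.subgroup_cyclic (L.map (AddMonoidHom.snd G ℤ))
    rw [← AddSubgroup.zmultiples_eq_closure] at ha
    rw [hd, ha, Int.index_zmultiples]
    simp
  have hmem : (d : ℤ) ∈ L.map (AddMonoidHom.snd G ℤ) := by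
    rw [hmap]; exact AddSubgroup.mem_zmultiples _
  obtain ⟨⟨g, z⟩, hg, hz⟩ := hmem
  have hz : z = d := hz
  subst hz
  refine ⟨QuotientAddGroup.mk g, ?_⟩
  have key : ∀ (a : G) (t : ℤ), (a, (d : ℤ) * t) ∈ L ↔
      (QuotientAddGroup.mk a : G ⧸ L.comap (AddMonoidHom.inl G ℤ)) = t • QuotientAddGroup.mk g := by
    intro a t
    rw [← QuotientAddGroup.mk_zsmul, eq_comm, QuotientAddGroup.eq, AddSubgroup.mem_comap]
    have : (a, (d : ℤ) * t) = t • (g, (d : ℤ)) + AddMonoidHom.inl G ℤ (-(t • g) + a) := by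
      ext <;> simp [mul_comm]
    rw [this, AddSubgroup.add_mem_cancel_left _ (L.zsmul_mem hg t)]
  ext ⟨a, z⟩
  rw [mem_latt]
  constructor
  · intro hx
    have : z ∈ AddSubgroup.zmultiples (d : ℤ) := by
      rw [← hmap]; exact ⟨_, hx, rfl⟩
    obtain ⟨t, rfl⟩ := AddSubgroup.mem_zmultiples_iff.1 this
    have e : t • (d : ℤ) = d * t := by simp [mul_comm]
    rw [e] at hx ⊢
    exact ⟨t, rfl, (key a t).1 hx⟩
  · rintro ⟨t, h1, h2⟩
    simp only at h1 h2
    rw [h1]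
    exact (key a t).2 h2

/-- parametrisation of sublattices -/
def lattMap (n : ℕ) (hn : n ≠ 0) :
    (Σ s : n.divisors, Σ M : {M : AddSubgroup G // M.index = s.1}, G ⧸ M.1) →
      {L : AddSubgroup (G × ℤ) // L.index = n} := fun x =>
  ⟨latt x.2.1.1 (n / x.1.1) x.2.2, by
    have h := Nat.dvd_of_mem_divisors x.1.2
    have : n / x.1.1 ≠ 0 := (Nat.div_ne_zero_iff_of_dvd h).2 ⟨hn, fun h0 => hn (by simpa [h0] using h)⟩
    rw [latt_index _ _ this, x.2.1.2, Nat.mul_div_cancel' h]⟩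

theorem lattMap_bij (n : ℕ) (hn : n ≠ 0) : Function.Bijective (lattMap (G := G) n hn) := by
  constructor
  · rintro ⟨⟨s, hs⟩, ⟨M, hM⟩, v⟩ ⟨⟨s', hs'⟩, ⟨M', hM'⟩, v'⟩ h
    simp only [lattMap, Subtype.mk.injEq] at h
    simp only at hM hM'
    have hdd : ∀ {s}, s ∈ n.divisors → n / s ≠ 0 := fun {s} hs => by
      have h := Nat.dvd_of_mem_divisors hs
      exact (Nat.div_ne_zero_iff_of_dvd h).2 ⟨hn, fun h0 => hn (by simpa [h0] using h)⟩
    have hMM : M = M' := by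
      rw [← latt_comap M _ (hdd hs) v, h, latt_comap M' _ (hdd hs')]
    subst hMM
    have hss : s = s' := hM.symm.trans hM'
    subst hss
    have hv : v = v' := by
      obtain ⟨g, rfl⟩ := QuotientAddGroup.mk_surjective v
      have : (g, ((n / s : ℕ) : ℤ)) ∈ latt M (n / s) v' := by
        rw [← h]; exact ⟨1, by simp, by simp⟩
      obtain ⟨t, h1, h2⟩ := this
      have h0 : ((n / s : ℕ) : ℤ) ≠ 0 := by exact_mod_cast hdd hs
      have : t = 1 := by
        have h1 : ((n / s : ℕ) : ℤ) * 1 = ((n / s : ℕ) : ℤ) * t := by rw [mul_one]; exact h1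
        exact (mul_left_cancel₀ h0 h1).symm
      rw [this, one_smul] at h2
      exact h2
    subst hv
    rfl
  · rintro ⟨L, hL⟩
    obtain ⟨v, hv⟩ := latt_surj L (hL ▸ hn)
    have hi := index_prod_eq L
    rw [hL] at hi
    refine ⟨⟨⟨(L.comap (AddMonoidHom.inl G ℤ)).index, ?_⟩, ⟨L.comap (AddMonoidHom.inl G ℤ), rfl⟩, v⟩, ?_⟩
    · exact Nat.mem_divisors.2 ⟨⟨_, hi⟩, hn⟩
    · simp only [lattMap, Subtype.mk.injEq]
      have h0 : (L.comap (AddMonoidHom.inl G ℤ)).index ≠ 0 := fun h => hn (by rw [hi, h, zero_mul])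
      have : n / (L.comap (AddMonoidHom.inl G ℤ)).index = (L.map (AddMonoidHom.snd G ℤ)).index := by
        conv_lhs => rw [hi]
        exact Nat.mul_div_cancel_left _ (Nat.pos_of_ne_zero h0)
      rw [this]
      exact hv.symm

theorem count_prod (hfin : ∀ s, s ≠ 0 → Finite {M : AddSubgroup G // M.index = s})
    (n : ℕ) (hn : n ≠ 0) :
    Finite {L : AddSubgroup (G × ℤ) // L.index = n} ∧
    Nat.card {L : AddSubgroup (G × ℤ) // L.index = n} =
      ∑ s ∈ n.divisors, s * Nat.card {M : AddSubgroup G // M.index = s} := by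
  have h0 : ∀ s : n.divisors, s.1 ≠ 0 := fun s h0 => hn (by
    simpa [h0] using Nat.dvd_of_mem_divisors s.2)
  have e := Equiv.ofBijective _ (lattMap_bij (G := G) n hn)
  have f1 : ∀ s : n.divisors, Finite {M : AddSubgroup G // M.index = s.1} := fun s => hfin _ (h0 s)
  have f2 : ∀ s : n.divisors, ∀ M : {M : AddSubgroup G // M.index = s.1}, Finite (G ⧸ M.1) := by
    intro s M
    have : M.1.FiniteIndex := ⟨by rw [M.2]; exact h0 s⟩
    exact AddSubgroup.finite_quotient_of_finiteIndex
  refine ⟨Finite.of_equiv _ e, ?_⟩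
  rw [← Nat.card_congr e, Nat.card_sigma, ← Finset.sum_coe_sort n.divisors]
  refine Finset.sum_congr rfl fun s _ => ?_
  have := Fintype.ofFinite {M : AddSubgroup G // M.index = s.1}
  rw [Nat.card_sigma, Finset.sum_congr rfl (g := fun _ => s.1) (fun M _ => M.2)]
  simp [mul_comm]

end lattice

theorem count_equiv {G G' : Type*} [AddCommGroup G] [AddCommGroup G'] (e : G ≃+ G') (n : ℕ) :
    Nonempty ({L : AddSubgroup G // L.index = n} ≃ {L : AddSubgroup G' // L.index = n}) :=
  ⟨e.mapAddSubgroup.toEquiv.subtypeEquiv fun L => by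
    have := AddSubgroup.index_map_equiv L e
    constructor
    · intro h; exact this.trans h
    · intro h; exact this.symm.trans h⟩

theorem count_step (p n : ℕ) :
    Nonempty ({L : AddSubgroup (Fin (p+1) → ℤ) // L.index = n} ≃
      {L : AddSubgroup ((Fin p → ℤ) × ℤ) // L.index = n}) := by
  refine count_equiv ?_ n
  exact
    { toFun := fun f => (Fin.init f, f (Fin.last p))
      invFun := fun x => Fin.snoc x.1 x.2
      left_inv := fun f => by simp
      right_inv := fun x => by simp
      map_add' := fun f g => rfl }

theorem count_B (p : ℕ) : ∀ n, n ≠ 0 →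
    Finite {L : AddSubgroup (Fin (p+1) → ℤ) // L.index = n} ∧
    Nat.card {L : AddSubgroup (Fin (p+1) → ℤ) // L.index = n} = B (p+1) n := by
  induction p with
  | zero =>
    intro n hn
    obtain ⟨e⟩ := count_step 0 n
    have hsub : ∀ L : AddSubgroup (Fin 0 → ℤ), L = ⊤ := fun L => by
      ext x
      rw [Subsingleton.elim x 0]
      exact ⟨fun _ => trivial, fun _ => L.zero_mem⟩
    have := count_prod (G := Fin 0 → ℤ) (fun s _ => by
      have : Subsingleton (AddSubgroup (Fin 0 → ℤ)) := ⟨fun a b => (hsub a).trans (hsub b).symm⟩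
      infer_instance) n hn
    refine ⟨?_, ?_⟩
    · have := this.1
      exact Finite.of_equiv _ e.symm
    · rw [Nat.card_congr e, this.2, B_one, Finset.sum_eq_single 1]
      · rw [one_mul, Nat.card_eq_one_iff_unique]
        exact ⟨⟨fun a b => Subtype.ext ((hsub _).trans (hsub _).symm)⟩, ⟨⊤, by simp⟩⟩
      · intro s _ hs
        have : IsEmpty {M : AddSubgroup (Fin 0 → ℤ) // M.index = s} :=
          ⟨fun M => hs (by rw [← M.2, hsub M.1, AddSubgroup.index_top])⟩
        simp
      · simp [hn]
  | succ p ih =>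
    intro n hn
    obtain ⟨e⟩ := count_step (p+1) n
    have := count_prod (G := Fin (p+1) → ℤ) (fun s hs => (ih s hs).1) n hn
    refine ⟨?_, ?_⟩
    · have := this.1
      exact Finite.of_equiv _ e.symm
    · rw [Nat.card_congr e, this.2, B_succ p n hn]
      refine Finset.sum_congr rfl fun s hs => ?_
      rw [(ih s fun h0 => hn (by simpa [h0] using Nat.dvd_of_mem_divisors hs)).2]

theorem count_mul (p : ℕ) : ∀ n, n ≠ 0 →
    Finite {L : Subgroup (Fin (p+1) → Multiplicative ℤ) // L.index = n} ∧
    Nat.card {L : Subgroup (Fin (p+1) → Multiplicative ℤ) // L.index = n} = B (p+1) n := by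
  intro n hn
  let e1 : Multiplicative (Fin (p+1) → ℤ) ≃* (Fin (p+1) → Multiplicative ℤ) :=
    MulEquiv.funMultiplicative _ _
  let e : {L : AddSubgroup (Fin (p+1) → ℤ) // L.index = n} ≃
      {L : Subgroup (Fin (p+1) → Multiplicative ℤ) // L.index = n} :=
    (AddSubgroup.toSubgroup.toEquiv.trans e1.mapSubgroup.toEquiv).subtypeEquiv fun L => by
      have h1 := Subgroup.index_map_equiv (AddSubgroup.toSubgroup L) e1
      have h2 := AddSubgroup.index_toSubgroup L
      constructor
      · intro h; exact (h1.trans h2).trans h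
      · intro h; exact (h1.trans h2).symm.trans h
  obtain ⟨h1, h2⟩ := count_B p n hn
  exact ⟨Finite.of_equiv _ e, by rw [← Nat.card_congr e, h2]⟩

section core
open MulAction
variable {G : Type*} [Group G] {X : Type*} {k : ℕ}

/-- class of a point in the orbit space -/
def cls (φ : G →* Equiv.Perm X) (x : X) : orbitRel.Quotient φ.range X := Quotient.mk _ x

theorem cls_eq (φ : G →* Equiv.Perm X) (x y : X) : cls φ x = cls φ y ↔ ∃ g, φ g y = x := by
  unfold cls
  rw [Quotient.eq, orbitRel_apply, mem_orbit_iff]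
  constructor
  · rintro ⟨⟨_, g, rfl⟩, h⟩; exact ⟨g, h⟩
  · rintro ⟨g, h⟩; exact ⟨⟨_, g, rfl⟩, h⟩

theorem cls_surj (φ : G →* Equiv.Perm X) : Function.Surjective (cls φ) := Quotient.mk_surjective

/-- point stabilizer -/
def st (φ : G →* Equiv.Perm X) (x : X) : Subgroup G := (stabilizer (Equiv.Perm X) x).comap φ

theorem mem_st (φ : G →* Equiv.Perm X) (x : X) (g : G) : g ∈ st φ x ↔ φ g x = x := Iff.rfl

theorem index_st (φ : G →* Equiv.Perm X) (x : X) :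
    (st φ x).index = Nat.card {y // cls φ y = cls φ x} := by
  have h1 : (stabilizer (Equiv.Perm X) x).subgroupOf φ.range = stabilizer φ.range x := by
    ext; rfl
  rw [st, Subgroup.index_comap, Subgroup.relIndex, h1, index_stabilizer]
  have : orbit φ.range x = {y | cls φ y = cls φ x} := by
    ext y
    rw [Set.mem_ofPred_eq, cls, cls, Quotient.eq, orbitRel_apply]
  rw [this]
  rfl

/-- transported action -/
def actHom (H : Fin k → Subgroup G) (e : (Σ i, G ⧸ H i) ≃ X) : G →* Equiv.Perm X :=
  (e.permCongrHom.toMonoidHom).comp (toPermHom G (Σ i, G ⧸ H i))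

theorem actHom_apply (H : Fin k → Subgroup G) (e : (Σ i, G ⧸ H i) ≃ X) (g : G) (z) :
    actHom H e g (e z) = e (g • z) := by
  simp [actHom]

theorem actHom_mk (H : Fin k → Subgroup G) (e : (Σ i, G ⧸ H i) ≃ X) (g : G) (i) :
    actHom H e g (e ⟨i, ((1 : G) : G ⧸ H i)⟩) = e ⟨i, (g : G ⧸ H i)⟩ := by
  rw [actHom_apply]
  congr 1
  rw [Sigma.smul_mk]
  congr 1
  change ((g * 1 : G) : G ⧸ H i) = g
  rw [mul_one]

/-- the points `b` form a transversal -/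
def IsTr (φ : G →* Equiv.Perm X) (b : Fin k → X) : Prop := Function.Bijective fun i => cls φ (b i)

theorem act_isTr (H : Fin k → Subgroup G) (e : (Σ i, G ⧸ H i) ≃ X) :
    IsTr (actHom H e) (fun i => e ⟨i, ((1 : G) : G ⧸ H i)⟩) := by
  constructor
  · intro i j h
    obtain ⟨g, hg⟩ := (cls_eq _ _ _).1 h
    rw [actHom_mk] at hg
    exact (congrArg Sigma.fst (e.injective hg)).symm
  · intro c
    obtain ⟨x, rfl⟩ := cls_surj _ c
    obtain ⟨⟨i, q⟩, rfl⟩ := e.surjective x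
    obtain ⟨g, rfl⟩ := QuotientGroup.mk_surjective q
    refine ⟨i, ?_⟩
    exact ((cls_eq _ _ _).2 ⟨g, actHom_mk H e g i⟩).symm

theorem act_st (H : Fin k → Subgroup G) (e : (Σ i, G ⧸ H i) ≃ X) (i) :
    st (actHom H e) (e ⟨i, ((1 : G) : G ⧸ H i)⟩) = H i := by
  ext g
  rw [mem_st, actHom_mk, e.apply_eq_iff_eq]
  simp only [Sigma.mk.injEq, heq_eq_eq, true_and]
  rw [eq_comm, QuotientGroup.eq]
  simp

/-- orbit decomposition map -/
def decMap (φ : G →* Equiv.Perm X) (b : Fin k → X) (H : Fin k → Subgroup G)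
    (hH : ∀ i, st φ (b i) = H i) : (Σ i, G ⧸ H i) → X := fun z =>
  Quotient.liftOn' z.2 (fun g => φ g (b z.1)) (by
    intro g h hgh
    rw [QuotientGroup.leftRel_apply, ← hH, mem_st, map_mul, map_inv, Equiv.Perm.mul_apply,
      Equiv.Perm.inv_eq_iff_eq] at hgh
    exact hgh.symm)

theorem decMap_bij (φ : G →* Equiv.Perm X) (b : Fin k → X) (H : Fin k → Subgroup G)
    (hH : ∀ i, st φ (b i) = H i) (hb : IsTr φ b) : Function.Bijective (decMap φ b H hH) := by
  constructor
  · rintro ⟨i, q⟩ ⟨j, r⟩ h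
    obtain ⟨g, rfl⟩ := QuotientGroup.mk_surjective q
    obtain ⟨g', rfl⟩ := QuotientGroup.mk_surjective r
    have h : φ g (b i) = φ g' (b j) := h
    have h2 : φ (g⁻¹ * g') (b j) = b i := by
      rw [map_mul, map_inv, Equiv.Perm.mul_apply, Equiv.Perm.inv_eq_iff_eq, h]
    have hij : i = j := hb.1 ((cls_eq _ _ _).2 ⟨_, h2⟩)
    subst hij
    congr 1
    rw [QuotientGroup.eq, ← hH]
    exact h2
  · intro x
    obtain ⟨i, hi⟩ := hb.2 (cls φ x)
    obtain ⟨g, hg⟩ := (cls_eq _ _ _).1 hi.symm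
    exact ⟨⟨i, (g : G ⧸ H i)⟩, hg⟩

/-- the parametrisation for fixed stabilizers -/
def parMap (H : Fin k → Subgroup G) (e : (Σ i, G ⧸ H i) ≃ X) :
    {y : (G →* Equiv.Perm X) × (Fin k → X) // IsTr y.1 y.2 ∧ ∀ i, st y.1 (y.2 i) = H i} :=
  ⟨(actHom H e, fun i => e ⟨i, ((1 : G) : G ⧸ H i)⟩), act_isTr H e, act_st H e⟩

theorem parMap_bij (H : Fin k → Subgroup G) : Function.Bijective (parMap (X := X) H) := by
  constructor
  · intro e e' h
    have h1 : actHom H e = actHom H e' := congrArg (fun z => z.1.1) h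
    have h2 : (fun i => e ⟨i, ((1 : G) : G ⧸ H i)⟩) = fun i => e' ⟨i, ((1 : G) : G ⧸ H i)⟩ :=
      congrArg (fun z => z.1.2) h
    ext ⟨i, q⟩
    obtain ⟨g, rfl⟩ := QuotientGroup.mk_surjective q
    rw [← actHom_mk H e, ← actHom_mk H e', h1]
    exact congrArg _ (congrFun h2 i)
  · rintro ⟨⟨φ, b⟩, hb, hH⟩
    let e := Equiv.ofBijective _ (decMap_bij φ b H hH hb)
    have he : ∀ i (g : G), e ⟨i, (g : G ⧸ H i)⟩ = φ g (b i) := fun i g => rfl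
    refine ⟨e, Subtype.ext (Prod.ext ?_ ?_)⟩
    · ext g x
      obtain ⟨⟨i, q⟩, rfl⟩ := e.surjective x
      obtain ⟨g', rfl⟩ := QuotientGroup.mk_surjective q
      change actHom H e g _ = φ g _
      rw [actHom_apply, Sigma.smul_mk]
      change e ⟨i, ((g * g' : G) : G ⧸ H i)⟩ = _
      rw [he, he, map_mul]; rfl
    · funext i
      change e ⟨i, ((1 : G) : G ⧸ H i)⟩ = b i
      rw [he, map_one]; rfl

variable [Fintype X]

theorem index_st_pos (φ : G →* Equiv.Perm X) (x : X) : 1 ≤ (st φ x).index := by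
  rw [index_st]
  have : Nonempty {y // cls φ y = cls φ x} := ⟨⟨x, rfl⟩⟩
  exact Nat.card_pos

theorem sum_index (φ : G →* Equiv.Perm X) (b : Fin k → X) (hb : IsTr φ b) :
    ∑ i, (st φ (b i)).index = Fintype.card X := by
  have e := Equiv.ofBijective _ (decMap_bij φ b _ (fun i => rfl) hb)
  have : ∀ i, Finite (G ⧸ st φ (b i)) := fun i => 
    Finite.of_injective (fun q => e ⟨i, q⟩) (fun q r h => by simpa using e.injective h)
  rw [← Nat.card_eq_fintype_card, ← Nat.card_congr e, Nat.card_sigma]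
  rfl

theorem card_fix (H : Fin k → Subgroup G) (h0 : ∀ i, (H i).index ≠ 0)
    (hs : ∑ i, (H i).index = Fintype.card X) :
    Nat.card {y : (G →* Equiv.Perm X) × (Fin k → X) // IsTr y.1 y.2 ∧ ∀ i, st y.1 (y.2 i) = H i} =
      (Fintype.card X).factorial := by
  classical
  rw [← Nat.card_congr (Equiv.ofBijective _ (parMap_bij (X := X) H))]
  have : ∀ i, Finite (G ⧸ H i) := fun i => by
    have : (H i).FiniteIndex := ⟨h0 i⟩
    exact Subgroup.finite_quotient_of_finiteIndex
  have := fun i => Fintype.ofFinite (G ⧸ H i)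
  have hc : Fintype.card (Σ i, G ⧸ H i) = Fintype.card X := by
    rw [← hs, ← Nat.card_eq_fintype_card, Nat.card_sigma]; rfl
  have e := Fintype.equivOfCardEq hc
  rw [Nat.card_eq_fintype_card, Fintype.card_equiv e, hc]

end core

theorem transversal_sum {X Q : Type*} [Fintype X] [Fintype Q] [DecidableEq X] [DecidableEq Q]
    (π : X → Q) (hπ : Function.Surjective π) (k : ℕ) [DecidablePred fun b : Fin k → X => Function.Bijective fun i => π (b i)] :
    (∑ b : Fin k → X with Function.Bijective (fun i => π (b i)),
      ∏ i, (1 : ℚ) / (Nat.card {y // π y = π (b i)} : ℚ)) =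
    if Nat.card Q = k then (k.factorial : ℚ) else 0 := by
  classical
  have h1 : ∀ c : Fin k → Q, ∑ b : Fin k → X with (fun i => π (b i)) = c,
      ∏ i, (1 : ℚ) / (Nat.card {y // π y = π (b i)} : ℚ) = 1 := by
    intro c
    have : (Finset.univ.filter fun b : Fin k → X => (fun i => π (b i)) = c) =
        Fintype.piFinset fun i => Finset.univ.filter fun x => π x = c i := by
      ext b; simp [funext_iff]
    rw [this, Finset.sum_congr rfl (g := fun b => ∏ i, (1 : ℚ) / (Nat.card {y // π y = c i} : ℚ)),
      Finset.sum_const, Fintype.card_piFinset, nsmul_eq_mul, Nat.cast_prod,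
      ← Finset.prod_mul_distrib]
    · apply Finset.prod_eq_one
      intro i _
      obtain ⟨x, hx⟩ := hπ (c i)
      have : Nonempty {y // π y = c i} := ⟨⟨x, hx⟩⟩
      have h0 : (Nat.card {y // π y = c i} : ℚ) ≠ 0 := by exact_mod_cast Nat.card_pos.ne'
      rw [← Fintype.card_subtype, ← Nat.card_eq_fintype_card, mul_one_div_cancel h0]
    · intro b hb
      simp only [Fintype.mem_piFinset, Finset.mem_filter, Finset.mem_univ, true_and] at hb
      simp only [hb]
  rw [← Finset.sum_fiberwise_of_maps_to
    (t := Finset.univ.filter fun c : Fin k → Q => Function.Bijective c)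
    (g := fun b i => π (b i)) (by intro b hb; simpa using hb)]
  rw [Finset.sum_congr rfl (g := fun _ => (1 : ℚ))]
  · rw [Finset.sum_const, nsmul_eq_mul, mul_one, ← Fintype.card_subtype,
      ← Nat.card_eq_fintype_card]
    have e : {c : Fin k → Q // Function.Bijective c} ≃ (Fin k ≃ Q) :=
      { toFun := fun c => Equiv.ofBijective c.1 c.2
        invFun := fun e => ⟨e, e.bijective⟩
        left_inv := fun c => rfl
        right_inv := fun e => by ext; rfl }
    rw [Nat.card_congr e]
    split_ifs with h
    · have e' : Fin k ≃ Q := Fintype.equivOfCardEq (by rw [← h, Nat.card_eq_fintype_card, Fintype.card_fin])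
      rw [Nat.card_eq_fintype_card, Fintype.card_equiv e', Fintype.card_fin]
    · have : IsEmpty (Fin k ≃ Q) := ⟨fun e => h (by rw [← Nat.card_congr e, Nat.card_fin])⟩
      simp
  · intro c hc
    refine Eq.trans ?_ (h1 c)
    refine Finset.sum_congr ?_ (fun _ _ => rfl)
    ext b
    simp only [Finset.mem_filter, Finset.mem_univ, true_and] at hc ⊢
    constructor
    · exact fun h => h.2
    · intro h; exact ⟨by rw [h]; exact hc, h⟩

section final
open MulAction

theorem main_count {G : Type*} [Group G] {X : Type*} [Fintype X] (k : ℕ)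
    [Finite (G →* Equiv.Perm X)]
    (hfin : ∀ m, m ≠ 0 → Finite {K : Subgroup G // K.index = m}) :
    (k.factorial : ℚ) * (Nat.card {φ : G →* Equiv.Perm X // Nat.card (orbitRel.Quotient φ.range X) = k} : ℚ)
     = ((Fintype.card X).factorial : ℚ) *
        ∑ ν ∈ Finset.filter (fun ν : Fin k → ℕ => ∑ i, ν i = Fintype.card X)
            (Fintype.piFinset fun _ => Finset.Icc 1 (Fintype.card X)),
          ∏ i, (Nat.card {K : Subgroup G // K.index = ν i} : ℚ) / (ν i : ℚ) := by
  classical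
  have := Fintype.ofFinite (G →* Equiv.Perm X)
  let w : (G →* Equiv.Perm X) × (Fin k → X) → ℚ := fun y => ∏ i, (1 : ℚ) / ((st y.1 (y.2 i)).index : ℚ)
  have lhs : ∑ y : (G →* Equiv.Perm X) × (Fin k → X) with IsTr y.1 y.2, w y =
      (k.factorial : ℚ) * (Nat.card {φ : G →* Equiv.Perm X // Nat.card (orbitRel.Quotient φ.range X) = k} : ℚ) := by
    rw [Finset.sum_filter, Fintype.sum_prod_type]
    have : ∀ φ : G →* Equiv.Perm X, (∑ b : Fin k → X, if IsTr φ b then w (φ, b) else 0) =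
        if Nat.card (orbitRel.Quotient φ.range X) = k then (k.factorial : ℚ) else 0 := by
      intro φ
      have := Fintype.ofFinite (orbitRel.Quotient φ.range X)
      rw [← transversal_sum (cls φ) (cls_surj φ) k, Finset.sum_filter]
      refine Finset.sum_congr rfl fun b _ => ?_
      simp only [w, index_st]
      exact if_congr Iff.rfl rfl rfl
    simp only [this]
    rw [← Finset.sum_filter, Finset.sum_const, nsmul_eq_mul, mul_comm, Nat.card_eq_fintype_card,
      Fintype.card_subtype]
  rw [← lhs]
  -- group by stabilizers
  have hS : ∀ m, m ≠ 0 → {K : Subgroup G | K.index = m}.Finite := fun m hm => hfin m hm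
  let S : ℕ → Finset (Subgroup G) := fun m => if h : m ≠ 0 then (hS m h).toFinset else ∅
  have memS : ∀ m, m ≠ 0 → ∀ K, K ∈ S m ↔ K.index = m := by
    intro m hm K
    simp [S, hm]
  have cardS : ∀ m, m ≠ 0 → (S m).card = Nat.card {K : Subgroup G // K.index = m} := by
    intro m hm
    simp only [S, dif_pos hm]
    exact (Nat.card_eq_card_finite_toFinset (hS m hm)).symm
  rw [← Finset.sum_fiberwise_of_maps_to (g := fun y i => (st y.1 (y.2 i)).index)
    (t := Finset.filter (fun ν : Fin k → ℕ => ∑ i, ν i = Fintype.card X)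
            (Fintype.piFinset fun _ => Finset.Icc 1 (Fintype.card X))), Finset.mul_sum]
  swap
  · intro y hy
    simp only [Finset.mem_filter, Finset.mem_univ, true_and] at hy
    have hs := sum_index y.1 y.2 hy
    simp only [Finset.mem_filter, Fintype.mem_piFinset, Finset.mem_Icc]
    refine ⟨fun i => ⟨index_st_pos _ _, ?_⟩, hs⟩
    rw [← hs]
    exact Finset.single_le_sum (f := fun i => (st y.1 (y.2 i)).index) (fun _ _ => Nat.zero_le _)
      (Finset.mem_univ i)
  refine Finset.sum_congr rfl fun ν hν => ?_
  simp only [Finset.mem_filter, Fintype.mem_piFinset, Finset.mem_Icc] at hν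
  have hν0 : ∀ i, ν i ≠ 0 := fun i => by have := (hν.1 i).1; omega
  rw [Finset.sum_congr rfl (g := fun _ => ∏ i, (1 : ℚ) / (ν i : ℚ))]
  swap
  · intro y hy
    rw [Finset.mem_filter] at hy
    simp only [w, ← hy.2]
  rw [Finset.sum_const, nsmul_eq_mul, Finset.card_eq_sum_card_fiberwise
    (f := fun y i => st y.1 (y.2 i)) (t := Fintype.piFinset fun i => S (ν i))]
  swap
  · intro y hy
    simp only [Finset.coe_filter, Set.mem_ofPred_eq] at hy
    simp only [SetLike.mem_coe, Fintype.mem_piFinset]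
    intro i
    rw [memS _ (hν0 i)]
    exact congrFun hy.2 i
  rw [Finset.sum_congr rfl (g := fun _ => (Fintype.card X).factorial)]
  · rw [Finset.sum_const, Fintype.card_piFinset, smul_eq_mul]
    push_cast
    rw [mul_comm (∏ i, _), mul_assoc, ← Finset.prod_mul_distrib]
    congr 1
    refine Finset.prod_congr rfl fun i _ => ?_
    rw [cardS _ (hν0 i), mul_one_div]
  · intro H hH
    simp only [Fintype.mem_piFinset] at hH
    have hH : ∀ i, (H i).index = ν i := fun i => (memS _ (hν0 i) _).1 (hH i)
    rw [← card_fix (X := X) H (fun i => by rw [hH]; exact hν0 i) (by simp only [hH]; exact hν.2),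
      Nat.card_eq_fintype_card, Fintype.card_subtype]
    congr 1
    ext y
    simp only [Finset.mem_filter, Finset.mem_univ, true_and]
    constructor
    · rintro ⟨⟨h1, h2⟩, h3⟩
      exact ⟨h1, fun i => congrFun h3 i⟩
    · rintro ⟨h1, h2⟩
      exact ⟨⟨h1, funext fun i => by rw [h2, hH]⟩, funext h2⟩
end final

/-- commuting tuples are homs -/
def tupEquiv (p : ℕ) (M : Type*) [Group M] :
    {σ : Fin p → M // ∀ i j, Commute (σ i) (σ j)} ≃ ((Fin p → Multiplicative ℤ) →* M) :=
  ((Equiv.piCongrRight fun _ => zpowersHom M).subtypeEquiv (by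
    intro σ
    constructor
    · intro h i j _ x y
      simp only [Equiv.piCongrRight_apply, Pi.map_apply, zpowersHom_apply]
      exact (h i j).zpow_zpow _ _
    · intro h i j
      by_cases hij : i = j
      · subst hij; exact Commute.refl _
      · have := h hij (Multiplicative.ofAdd 1) (Multiplicative.ofAdd 1)
        simpa [zpowersHom_apply] using this)).trans
    MonoidHom.noncommPiCoprodEquiv

theorem tupEquiv_range (p : ℕ) (M : Type*) [Group M]
    (σ : {σ : Fin p → M // ∀ i j, Commute (σ i) (σ j)}) :
    (tupEquiv p M σ).range = Subgroup.closure (Set.range σ.1) := by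
  refine (MonoidHom.noncommPiCoprod_range (ϕ := fun i => zpowersHom M (σ.1 i))
    (hcomm := fun i j _ x y => (σ.2 i j).zpow_zpow _ _)).trans ?_
  rw [← Set.iUnion_singleton_eq_range, Subgroup.closure_iUnion]
  congr 1
  funext i
  rw [← Subgroup.zpowers_eq_closure]
  ext x
  simp only [MonoidHom.mem_range, Subgroup.mem_zpowers_iff]
  constructor
  · rintro ⟨z, rfl⟩; exact ⟨z.toAdd, rfl⟩
  · rintro ⟨z, rfl⟩; exact ⟨Multiplicative.ofAdd z, rfl⟩

theorem A_eq (p n k : ℕ) : A p n k = Nat.card {φ : (Fin p → Multiplicative ℤ) →* Equiv.Perm (Fin n) //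
    Nat.card (MulAction.orbitRel.Quotient φ.range (Fin n)) = k} := by
  unfold A
  refine Nat.card_congr ((Equiv.subtypeSubtypeEquivSubtypeInter _ _).symm.trans
    ((tupEquiv p _).subtypeEquiv fun σ => ?_))
  rw [tupEquiv_range]

theorem stmt0 (p n k : ℕ) (hp : 1 ≤ p) (hn : 1 ≤ n) (hk : k ≤ n) :
    (A p n k : ℚ) =
      (n.factorial : ℚ) / (k.factorial : ℚ) *
        ∑ ν ∈ Finset.filter (fun ν : Fin k → ℕ => ∑ i, ν i = n)
            (Fintype.piFinset fun _ => Finset.Icc 1 n),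
          ∏ i, (B p (ν i) : ℚ) / (ν i : ℚ) := by
  obtain ⟨q, rfl⟩ : ∃ q, p = q + 1 := ⟨p - 1, by omega⟩
  have hF : Finite ((Fin (q+1) → Multiplicative ℤ) →* Equiv.Perm (Fin n)) :=
    Finite.of_equiv _ (tupEquiv (q+1) (Equiv.Perm (Fin n)))
  have h := main_count (G := Fin (q+1) → Multiplicative ℤ) (X := Fin n) k
    (fun m hm => (count_mul q m hm).1)
  rw [Fintype.card_fin, ← A_eq] at h
  have hk0 : (k.factorial : ℚ) ≠ 0 := by exact_mod_cast k.factorial_ne_zero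
  rw [div_mul_eq_mul_div, eq_div_iff hk0, mul_comm, h]
  congr 1
  refine Finset.sum_congr rfl fun ν hν => Finset.prod_congr rfl fun i _ => ?_
  simp only [Finset.mem_filter, Fintype.mem_piFinset, Finset.mem_Icc] at hν
  rw [(count_mul q (ν i) (by have := (hν.1 i).1; omega)).2]
end

section
/- For all integers p ≥ 1 and n ≥ 1, A(p+1,n,1) = Σ_{r·s = n} A(p,s,1) · (n!/(r!·(s!)^r)) · (r−1)! · (s!)^{r−1} · s, where the sum is over ordered pairs of positive integers (r,s) with r·s = n. -/
theorem idx_prod {B : Type*} [AddCommGroup B] (H : AddSubgroup (B × ℤ)) :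
    H.index = (H.comap (AddMonoidHom.inl B ℤ)).index * (H.map (AddMonoidHom.snd B ℤ)).index := by
  have hs : Function.Surjective (AddMonoidHom.snd B ℤ) := fun m => ⟨(0, m), rfl⟩
  rw [AddSubgroup.index_comap, ← AddSubgroup.relIndex_sup_right,
    ← AddSubgroup.index_comap_of_surjective _ hs, AddSubgroup.comap_map_eq,
    sup_comm]
  have e : (AddMonoidHom.inl B ℤ).range = (AddMonoidHom.snd B ℤ).ker := by
    ext ⟨x, m⟩
    rw [AddMonoidHom.mem_ker, AddMonoidHom.mem_range]
    constructor
    · rintro ⟨y, hy⟩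
      exact (congrArg Prod.snd hy).symm
    · intro hm
      exact ⟨x, Prod.ext rfl hm.symm⟩
  rw [e]
  exact (AddSubgroup.relIndex_mul_index le_sup_left).symm

def mkH {B : Type*} [AddCommGroup B] (r : ℤ) (K : AddSubgroup B) (c : B ⧸ K) :
    AddSubgroup (B × ℤ) where
  carrier := {x | ∃ k : ℤ, x.2 = k * r ∧ (x.1 : B ⧸ K) = k • c}
  zero_mem' := ⟨0, by simp, by simp⟩
  add_mem' := by
    rintro x y ⟨k, h1, h2⟩ ⟨l, h3, h4⟩
    exact ⟨k + l, by simp [h1, h3, add_mul], by simp [h2, h4, add_smul]⟩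
  neg_mem' := by
    rintro x ⟨k, h1, h2⟩
    exact ⟨-k, by simp [h1], by simp [h2]⟩

theorem mem_mkH {B : Type*} [AddCommGroup B] (r : ℤ) (K : AddSubgroup B) (c : B ⧸ K) (x : B × ℤ) :
    x ∈ mkH r K c ↔ ∃ k : ℤ, x.2 = k * r ∧ (x.1 : B ⧸ K) = k • c := Iff.rfl

theorem mkH_comap {B : Type*} [AddCommGroup B] (r : ℤ) (hr : r ≠ 0) (K : AddSubgroup B)
    (c : B ⧸ K) : (mkH r K c).comap (AddMonoidHom.inl B ℤ) = K := by
  ext x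
  simp only [AddSubgroup.mem_comap, mem_mkH, AddMonoidHom.inl_apply]
  constructor
  · rintro ⟨k, h1, h2⟩
    have : k = 0 := by
      rcases mul_eq_zero.1 h1.symm with h | h
      · exact h
      · exact absurd h hr
    subst this
    simpa using h2
  · intro h
    exact ⟨0, by simp, by simpa using h⟩

theorem mkH_map {B : Type*} [AddCommGroup B] (r : ℤ) (K : AddSubgroup B)
    (c : B ⧸ K) : (mkH r K c).map (AddMonoidHom.snd B ℤ) = AddSubgroup.zmultiples r := by
  ext m
  simp only [AddSubgroup.mem_map, mem_mkH, AddSubgroup.mem_zmultiples_iff, AddMonoidHom.coe_snd]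
  constructor
  · rintro ⟨x, ⟨k, h1, h2⟩, rfl⟩
    exact ⟨k, by simp [h1]⟩
  · rintro ⟨k, rfl⟩
    obtain ⟨b, rfl⟩ := QuotientAddGroup.mk_surjective c
    exact ⟨(k • b, k • r), ⟨k, by simp, by simp⟩, rfl⟩

theorem mkH_index {B : Type*} [AddCommGroup B] (r : ℕ) (hr : r ≠ 0) (K : AddSubgroup B)
    (c : B ⧸ K) : (mkH r K c).index = r * K.index := by
  rw [idx_prod, mkH_comap _ (by exact_mod_cast hr), mkH_map, Int.index_zmultiples]
  simp [mul_comm]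

theorem mkH_surj {B : Type*} [AddCommGroup B] (H : AddSubgroup (B × ℤ)) (r : ℕ)
    (h : H.map (AddMonoidHom.snd B ℤ) = AddSubgroup.zmultiples (r : ℤ)) :
    ∃ c, mkH r (H.comap (AddMonoidHom.inl B ℤ)) c = H := by
  have h1 : (r : ℤ) ∈ H.map (AddMonoidHom.snd B ℤ) := by
    rw [h]; exact AddSubgroup.mem_zmultiples _
  obtain ⟨⟨g, m⟩, hg, hm⟩ := h1
  simp only [AddMonoidHom.coe_snd] at hm
  subst hm
  refine ⟨(g : B ⧸ _), ?_⟩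
  ext ⟨x, m⟩
  have key : ∀ k : ℤ, m = k * r →
      (((x : B ⧸ (H.comap (AddMonoidHom.inl B ℤ))) = k • (g : B ⧸ _)) ↔ (x, m) ∈ H) := by
    intro k hk
    rw [← QuotientAddGroup.mk_zsmul, eq_comm, QuotientAddGroup.eq, AddSubgroup.mem_comap]
    have e : (AddMonoidHom.inl B ℤ) (-(k • g) + x) = -(k • (g, (r : ℤ))) + (x, m) := by
      ext <;> simp [hk]
    rw [e]
    exact AddSubgroup.add_mem_cancel_left _ (neg_mem (AddSubgroup.zsmul_mem _ hg k))
  rw [mem_mkH]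
  constructor
  · rintro ⟨k, h1, h2⟩
    exact (key k h1).1 h2
  · intro hx
    have : m ∈ H.map (AddMonoidHom.snd B ℤ) := ⟨_, hx, rfl⟩
    rw [h, AddSubgroup.mem_zmultiples_iff] at this
    obtain ⟨k, hk⟩ := this
    have hk' : m = k * r := by simpa using hk.symm
    exact ⟨k, hk', (key k hk').2 hx⟩

theorem card_sub_prod (B : Type*) [AddCommGroup B] (n : ℕ) (hn : 1 ≤ n)
    (hfin : ∀ s, 1 ≤ s → Finite {K : AddSubgroup B // K.index = s}) :
    Nat.card {H : AddSubgroup (B × ℤ) // H.index = n} =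
      ∑ rs ∈ n.divisorsAntidiagonal, Nat.card {K : AddSubgroup B // K.index = rs.2} * rs.2 := by
  classical
  let T := Σ rs : {x // x ∈ n.divisorsAntidiagonal},
    Σ K : {K : AddSubgroup B // K.index = rs.1.2}, B ⧸ K.1
  have hpos : ∀ rs : {x // x ∈ n.divisorsAntidiagonal}, rs.1.1 ≠ 0 ∧ rs.1.2 ≠ 0 := by
    rintro ⟨⟨r, s⟩, h⟩
    have := (Nat.mem_divisorsAntidiagonal.1 h)
    constructor <;> rintro h0 <;> simp only at h0 <;> subst h0 <;> simp at this <;> omega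
  let f : T → {H : AddSubgroup (B × ℤ) // H.index = n} := fun t =>
    ⟨mkH (t.1.1.1 : ℤ) t.2.1.1 t.2.2, by
      rw [mkH_index _ (hpos t.1).1, t.2.1.2]
      exact (Nat.mem_divisorsAntidiagonal.1 t.1.2).1⟩
  have hf : Function.Bijective f := by
    constructor
    · rintro ⟨⟨⟨r, s⟩, h⟩, ⟨K, hK⟩, c⟩ ⟨⟨⟨r', s'⟩, h'⟩, ⟨K', hK'⟩, c'⟩ he
      have hr := (hpos ⟨_, h⟩).1
      have hr' := (hpos ⟨_, h'⟩).1
      have he : mkH (r : ℤ) K c = mkH (r' : ℤ) K' c' := congrArg Subtype.val he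
      simp only at hr hr' hK hK'
      have e1 : r = r' := by
        have := congrArg (fun H => (H.map (AddMonoidHom.snd B ℤ)).index) he
        simpa [mkH_map, Int.index_zmultiples] using this
      have e2 : K = K' := by
        have := congrArg (fun H => (H.comap (AddMonoidHom.inl B ℤ))) he
        simpa only [mkH_comap _ (Int.natCast_ne_zero.2 hr),
          mkH_comap _ (Int.natCast_ne_zero.2 hr')] using this
      subst e1 e2
      have e3 : s = s' := hK.symm.trans hK'
      subst e3
      have e4 : c = c' := by
        obtain ⟨b, rfl⟩ := QuotientAddGroup.mk_surjective c
        have : (b, (r : ℤ)) ∈ mkH (r : ℤ) K (b : B ⧸ K) := ⟨1, by simp, by simp⟩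
        rw [he] at this
        obtain ⟨k, h1, h2⟩ := this
        have : k = 1 := by
          have hr0 : (r : ℤ) ≠ 0 := Int.natCast_ne_zero.2 hr
          simp only at h1
          exact mul_right_cancel₀ hr0 (by rw [← h1, one_mul])
        subst this
        simpa using h2
      subst e4
      rfl
    · rintro ⟨H, hH⟩
      obtain ⟨a, ha⟩ := Int.subgroup_cyclic (H.map (AddMonoidHom.snd B ℤ))
      have ha' : H.map (AddMonoidHom.snd B ℤ) = AddSubgroup.zmultiples (a.natAbs : ℤ) := by
        rw [ha, ← AddSubgroup.zmultiples_eq_closure, Int.zmultiples_natAbs]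
      obtain ⟨c, hc⟩ := mkH_surj H _ ha'
      have hi := idx_prod H
      rw [ha', Int.index_zmultiples, hH] at hi
      refine ⟨⟨⟨(a.natAbs, (H.comap (AddMonoidHom.inl B ℤ)).index), ?_⟩, ⟨_, rfl⟩, c⟩,
        Subtype.ext hc⟩
      rw [Nat.mem_divisorsAntidiagonal]
      exact ⟨by rw [Int.natAbs_natCast, mul_comm] at hi; exact hi.symm, by omega⟩
  rw [← Nat.card_congr (Equiv.ofBijective f hf)]
  have hfin1 : ∀ rs : {x // x ∈ n.divisorsAntidiagonal},
      Finite {K : AddSubgroup B // K.index = rs.1.2} := fun rs =>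
    hfin _ (Nat.one_le_iff_ne_zero.2 (hpos rs).2)
  have hfin2 : ∀ rs : {x // x ∈ n.divisorsAntidiagonal},
      ∀ K : {K : AddSubgroup B // K.index = rs.1.2}, Finite (B ⧸ K.1) := fun rs K =>
    Nat.finite_of_card_ne_zero (by
      change K.1.index ≠ 0
      rw [K.2]; exact (hpos rs).2)
  rw [Nat.card_sigma, ← Finset.sum_coe_sort n.divisorsAntidiagonal]
  refine Finset.sum_congr rfl fun rs _ => ?_
  have := Fintype.ofFinite {K : AddSubgroup B // K.index = rs.1.2}
  rw [Nat.card_sigma, Finset.sum_congr rfl (fun K _ => (K.2 : Nat.card (B ⧸ K.1) = _))]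
  simp

theorem card_fix_s6 (m : ℕ) : Nat.card {e : Equiv.Perm (Fin (m+1)) // e 0 = 0} = m.factorial := by
  have h := MulAction.index_stabilizer_of_transitive (Equiv.Perm (Fin (m+1))) (0 : Fin (m+1))
  have h2 := Subgroup.card_mul_index (MulAction.stabilizer (Equiv.Perm (Fin (m+1))) (0 : Fin (m+1)))
  rw [h] at h2
  simp only [Nat.card_eq_fintype_card, Fintype.card_perm, Fintype.card_fin, Nat.factorial_succ] at h2
  rw [← Nat.card_eq_fintype_card, mul_comm] at h2
  exact Nat.eq_of_mul_eq_mul_left (Nat.succ_pos m) h2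

theorem card_fix' (m : ℕ) {X : Type*} (x : X) (hX : Nat.card X = m + 1) :
    Nat.card {e : X ≃ Fin (m+1) // e x = 0} = m.factorial := by
  have : Finite X := Nat.finite_of_card_ne_zero (by omega)
  obtain ⟨e0⟩ : Nonempty (X ≃ Fin (m+1)) := ⟨Finite.equivFinOfCardEq hX⟩
  let e1 := e0.trans (Equiv.swap (e0 x) 0)
  have h1 : e1 x = 0 := by simp [e1]
  rw [← card_fix_s6 m]
  refine Nat.card_congr ⟨fun e => ⟨e1.symm.trans e.1, ?_⟩, fun e => ⟨e1.trans e.1, ?_⟩, ?_, ?_⟩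
  · rw [Equiv.trans_apply, (Equiv.symm_apply_eq e1).2 h1.symm, e.2]
  · rw [Equiv.trans_apply, h1, e.2]
  · intro e; ext; simp
  · intro e; ext; simp

theorem card_trans (G : Type*) [Group G] (m : ℕ)
    (hfin : Finite {φ : G →* Equiv.Perm (Fin (m+1)) // ∀ x, ∃ g, φ g 0 = x}) :
    Finite {H : Subgroup G // H.index = m + 1} ∧
    Nat.card {φ : G →* Equiv.Perm (Fin (m+1)) // ∀ x, ∃ g, φ g 0 = x} =
      Nat.card {H : Subgroup G // H.index = m + 1} * m.factorial := by
  let T := Σ H : {H : Subgroup G // H.index = m + 1},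
    {e : (G ⧸ H.1) ≃ Fin (m+1) // e ((1 : G) : G ⧸ H.1) = 0}
  let f : T → {φ : G →* Equiv.Perm (Fin (m+1)) // ∀ x, ∃ g, φ g 0 = x} := fun t =>
    ⟨(t.2.1.permCongrHom.toMonoidHom).comp (MulAction.toPermHom G (G ⧸ t.1.1)), by
      intro x
      obtain ⟨g, hg⟩ := QuotientGroup.mk_surjective (t.2.1.symm x)
      refine ⟨g, ?_⟩
      have h0 : t.2.1.symm 0 = ((1 : G) : G ⧸ t.1.1) :=
        (Equiv.symm_apply_eq _).2 t.2.2.symm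
      simp [Equiv.permCongrHom, h0]
      rw [← Equiv.eq_symm_apply, ← hg]⟩
  have hfv : ∀ (t : T) (g : G), (f t).1 g 0 = t.2.1 (g : G ⧸ t.1.1) := by
    intro t g
    have h0 : t.2.1.symm 0 = ((1 : G) : G ⧸ t.1.1) :=
        (Equiv.symm_apply_eq _).2 t.2.2.symm
    simp [f, Equiv.permCongrHom, h0]
  have hf : Function.Bijective f := by
    constructor
    · rintro ⟨⟨H, hH⟩, e, he⟩ ⟨⟨H', hH'⟩, e', he'⟩ h
      have hv : ∀ g : G, e (g : G ⧸ H) = e' (g : G ⧸ H') := by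
        intro g
        have h1 := hfv ⟨⟨H, hH⟩, e, he⟩ g
        have h2 := hfv ⟨⟨H', hH'⟩, e', he'⟩ g
        rw [h] at h1
        exact h1.symm.trans h2
      have e2 : H = H' := by
        ext g
        have a1 : (g : G ⧸ H) = ((1 : G) : G ⧸ H) ↔ g ∈ H := by
          rw [eq_comm, QuotientGroup.eq]; simp
        have a2 : (g : G ⧸ H') = ((1 : G) : G ⧸ H') ↔ g ∈ H' := by
          rw [eq_comm, QuotientGroup.eq]; simp
        rw [← a1, ← a2, ← e.apply_eq_iff_eq, ← e'.apply_eq_iff_eq, hv, hv]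
      subst e2
      have e3 : e = e' := by
        ext x
        obtain ⟨g, rfl⟩ := QuotientGroup.mk_surjective x
        rw [hv]
      subst e3
      rfl
    · rintro ⟨φ, hφ⟩
      let : MulAction G (Fin (m+1)) := MulAction.compHom _ φ
      have hsm : ∀ (g : G) (x : Fin (m+1)), g • x = φ g x := fun _ _ => rfl
      have hb : Function.Bijective (MulAction.ofQuotientStabilizer G (0 : Fin (m+1))) := by
        refine ⟨MulAction.injective_ofQuotientStabilizer G _, fun x => ?_⟩
        obtain ⟨g, hg⟩ := hφ x
        exact ⟨(g : G ⧸ MulAction.stabilizer G (0 : Fin (m+1))), hg⟩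
      let e := Equiv.ofBijective _ hb
      have he : ∀ g : G, e (g : G ⧸ _) = φ g 0 := fun _ => rfl
      have hidx : (MulAction.stabilizer G (0 : Fin (m+1))).index = m + 1 := by
        exact (Nat.card_congr e).trans (Nat.card_fin _)
      refine ⟨⟨⟨MulAction.stabilizer G (0 : Fin (m+1)), hidx⟩, e, ?_⟩, ?_⟩
      · rw [he]; simp
      · apply Subtype.ext
        ext g x : 2
        obtain ⟨k, rfl⟩ := hφ x
        have h1 := hfv ⟨⟨MulAction.stabilizer G (0 : Fin (m+1)), hidx⟩, e, by rw [he]; simp⟩ k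
        have h2 := hfv ⟨⟨MulAction.stabilizer G (0 : Fin (m+1)), hidx⟩, e, by rw [he]; simp⟩ (g * k)
        simp only [he, map_mul, Equiv.Perm.mul_apply] at h1 h2
        rw [h1] at h2
        exact h2
  have hT : Finite T := Finite.of_injective f hf.1
  have hc : ∀ H : {H : Subgroup G // H.index = m + 1},
    Nat.card {e : (G ⧸ H.1) ≃ Fin (m+1) // e ((1 : G) : G ⧸ H.1) = 0} = m.factorial := fun H =>
      card_fix' m _ H.2
  have hfH : Finite {H : Subgroup G // H.index = m + 1} := by
    refine Finite.of_surjective (fun t : T => t.1) fun H => ?_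
    have : 0 < Nat.card {e : (G ⧸ H.1) ≃ Fin (m+1) // e ((1 : G) : G ⧸ H.1) = 0} := by
      rw [hc]; exact Nat.factorial_pos m
    obtain ⟨⟨e⟩, _⟩ := Nat.card_pos_iff.1 this
    exact ⟨⟨H, e⟩, rfl⟩
  refine ⟨hfH, ?_⟩
  have := Fintype.ofFinite {H : Subgroup G // H.index = m + 1}
  have hff : ∀ H : {H : Subgroup G // H.index = m + 1},
    Finite {e : (G ⧸ H.1) ≃ Fin (m+1) // e ((1 : G) : G ⧸ H.1) = 0} := fun H =>
      Nat.finite_of_card_ne_zero (by rw [hc]; exact Nat.factorial_ne_zero m)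
  rw [← Nat.card_congr (Equiv.ofBijective f hf), Nat.card_sigma, Finset.sum_congr rfl fun H _ => hc H]
  simp

theorem orbits_one (m : ℕ) (S : Subgroup (Equiv.Perm (Fin (m+1)))) :
    Nat.card (MulAction.orbitRel.Quotient S (Fin (m+1))) = 1 ↔
      ∀ x, ∃ g ∈ S, g (0 : Fin (m+1)) = x := by
  rw [Nat.card_eq_one_iff_unique]
  constructor
  · rintro ⟨h, _⟩ x
    have := (MulAction.pretransitive_iff_subsingleton_quotient S (Fin (m+1))).2 h
    obtain ⟨g, hg⟩ := MulAction.exists_smul_eq S (0 : Fin (m+1)) x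
    exact ⟨g.1, g.2, hg⟩
  · intro h
    refine ⟨(MulAction.pretransitive_iff_subsingleton_quotient S (Fin (m+1))).1 ?_,
      ⟨(Quotient.mk'' (0 : Fin (m+1)) : MulAction.orbitRel.Quotient S (Fin (m+1)))⟩⟩
    refine ⟨fun x y => ?_⟩
    obtain ⟨g, hg, rfl⟩ := h x
    obtain ⟨k, hk, rfl⟩ := h y
    refine ⟨(⟨k * g⁻¹, S.mul_mem hk (S.inv_mem hg)⟩ : S), ?_⟩
    simp [Subgroup.smul_def]

theorem closure_single (p : ℕ) :
    Subgroup.closure (Set.range fun i : Fin p =>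
      (Pi.mulSingle i (Multiplicative.ofAdd (1 : ℤ)) : Fin p → Multiplicative ℤ)) = ⊤ := by
  rw [eq_top_iff]
  intro x _
  rw [← Finset.univ_prod_mulSingle x]
  refine Subgroup.prod_mem _ fun i _ => ?_
  have : (Pi.mulSingle i (x i) : Fin p → Multiplicative ℤ) =
      (Pi.mulSingle i (Multiplicative.ofAdd (1 : ℤ))) ^ (Multiplicative.toAdd (x i)) := by
    rw [← Pi.mulSingle_zpow, ← ofAdd_zsmul]
    simp
  rw [this]
  exact Subgroup.zpow_mem _ (Subgroup.subset_closure (Set.mem_range_self i)) _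

theorem A_eq_s6 (p m : ℕ) : A p (m+1) 1 =
    Nat.card {φ : (Fin p → Multiplicative ℤ) →* Equiv.Perm (Fin (m+1)) // ∀ x, ∃ g, φ g 0 = x} ∧
    Finite {φ : (Fin p → Multiplicative ℤ) →* Equiv.Perm (Fin (m+1)) // ∀ x, ∃ g, φ g 0 = x} := by
  let f : ((Fin p → Multiplicative ℤ) →* Equiv.Perm (Fin (m+1))) →
    Fin p → Equiv.Perm (Fin (m+1)) := fun φ i =>
      φ (Pi.mulSingle i (Multiplicative.ofAdd (1 : ℤ)))
  have hinj : Function.Injective f := by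
    intro φ ψ h
    refine MonoidHom.pi_ext fun i x => ?_
    have h1 : φ.comp (MonoidHom.mulSingle _ i) = ψ.comp (MonoidHom.mulSingle _ i) :=
      MonoidHom.ext_mint (congrFun h i)
    exact DFunLike.congr_fun h1 x
  have hcl : ∀ φ, Subgroup.closure (Set.range (f φ)) = φ.range := by
    intro φ
    rw [MonoidHom.range_eq_map, ← closure_single, MonoidHom.map_closure, ← Set.range_comp]
    rfl
  have htr : ∀ φ, Nat.card (MulAction.orbitRel.Quotient
      (Subgroup.closure (Set.range (f φ))) (Fin (m+1))) = 1 ↔ ∀ x, ∃ g, φ g 0 = x := by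
    intro φ
    rw [orbits_one, hcl]
    simp
  have hcomm : ∀ φ i j, Commute (f φ i) (f φ j) := fun φ i j => (Commute.all _ _).map φ
  refine ⟨?_, Finite.of_injective (fun φ => f φ.1) fun a b h => Subtype.ext (hinj h)⟩
  unfold A
  symm
  refine Nat.card_congr (Equiv.ofBijective (fun φ => ⟨f φ.1, hcomm φ.1, (htr φ.1).2 φ.2⟩) ⟨?_, ?_⟩)
  · intro a b h
    exact Subtype.ext (hinj (congrArg Subtype.val h))
  · rintro ⟨σ, hσ, ht⟩
    have hc : Pairwise fun i j => ∀ x y, Commute (zpowersHom (Equiv.Perm (Fin (m+1))) (σ i) x)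
        (zpowersHom (Equiv.Perm (Fin (m+1))) (σ j) y) := by
      intro i j _ x y
      simp only [zpowersHom_apply]
      exact ((hσ i j).zpow_zpow _ _)
    let φ := MonoidHom.noncommPiCoprod (fun i => zpowersHom (Equiv.Perm (Fin (m+1))) (σ i)) hc
    have hφ : f φ = σ := by
      funext i
      exact (MonoidHom.noncommPiCoprod_mulSingle (hcomm := hc) _ i _).trans (by simp)
    refine ⟨⟨φ, (htr φ).1 (by rw [hφ]; exact ht)⟩, Subtype.ext hφ⟩

noncomputable def Sc (p n : ℕ) : ℕ := Nat.card {H : Subgroup (Fin p → Multiplicative ℤ) // H.index = n}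

theorem A_Sc (p n : ℕ) (hn : 1 ≤ n) : A p n 1 = Sc p n * (n - 1).factorial := by
  obtain ⟨m, rfl⟩ : ∃ m, n = m + 1 := ⟨n - 1, by omega⟩
  rw [(A_eq_s6 p m).1, (card_trans _ m (A_eq_s6 p m).2).2]
  rfl

theorem Sc_add {G B : Type*} [Group G] [AddGroup B] (e : Additive G ≃+ B) (n : ℕ) :
    Nonempty ({H : Subgroup G // H.index = n} ≃ {H : AddSubgroup B // H.index = n}) := by
  refine ⟨Equiv.subtypeEquiv (Subgroup.toAddSubgroup.toEquiv.trans
    e.mapAddSubgroup.toEquiv) fun H => ?_⟩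
  have : ((Subgroup.toAddSubgroup.toEquiv.trans e.mapAddSubgroup.toEquiv) H).index = H.index := by
    change ((Subgroup.toAddSubgroup H).map (e : Additive G →+ B)).index = _
    rw [AddSubgroup.index_map_equiv, Subgroup.index_toAddSubgroup]
  rw [this]

def eqv (p : ℕ) : Additive (Fin (p+1) → Multiplicative ℤ) ≃+
    Additive (Fin p → Multiplicative ℤ) × ℤ where
  toFun x := (Additive.ofMul (fun i => x.toMul i.succ), (x.toMul 0).toAdd)
  invFun y := Additive.ofMul (Fin.cons (Multiplicative.ofAdd y.2) y.1.toMul)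
  left_inv x := by
    apply Additive.toMul.injective
    funext i
    refine Fin.cases ?_ (fun i => ?_) i <;> simp
  right_inv y := by
    rcases y with ⟨a, b⟩
    simp
  map_add' x y := rfl

theorem Sc_succ (p n : ℕ) (hn : 1 ≤ n) :
    Sc (p+1) n = ∑ rs ∈ n.divisorsAntidiagonal, Sc p rs.2 * rs.2 := by
  obtain ⟨e⟩ := Sc_add (eqv p) n
  have e2 : ∀ s, Nonempty ({H : Subgroup (Fin p → Multiplicative ℤ) // H.index = s} ≃
    {H : AddSubgroup (Additive (Fin p → Multiplicative ℤ)) // H.index = s}) := fun s =>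
      Sc_add (AddEquiv.refl _) s
  unfold Sc
  rw [Nat.card_congr e, card_sub_prod _ n hn]
  · refine Finset.sum_congr rfl fun rs _ => ?_
    rw [Nat.card_congr (e2 rs.2).some]
  · intro s hs
    obtain ⟨m, rfl⟩ : ∃ m, s = m + 1 := ⟨s - 1, by omega⟩
    have := (card_trans _ m (A_eq_s6 p m).2).1
    exact Finite.of_equiv _ (e2 (m+1)).some

theorem stmt6 (p n : ℕ) (hp : 1 ≤ p) (hn : 1 ≤ n) :
    (A (p + 1) n 1 : ℚ) =
      ∑ rs ∈ n.divisorsAntidiagonal,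
        (A p rs.2 1 : ℚ) *
          ((n.factorial : ℚ) / ((rs.1.factorial : ℚ) * (rs.2.factorial : ℚ) ^ rs.1)) *
          ((rs.1 - 1).factorial : ℚ) * ((rs.2.factorial : ℚ)) ^ (rs.1 - 1) * (rs.2 : ℚ) := by
  rw [A_Sc _ _ hn, Sc_succ _ _ hn, Finset.sum_mul, Nat.cast_sum]
  refine Finset.sum_congr rfl ?_
  rintro ⟨r, s⟩ h
  obtain ⟨h1, h2⟩ := Nat.mem_divisorsAntidiagonal.1 h
  simp only at h1 ⊢
  have hr : r ≠ 0 := by rintro rfl; simp at h1; omega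
  have hs : s ≠ 0 := by rintro rfl; simp at h1; omega
  rw [A_Sc p s (Nat.one_le_iff_ne_zero.2 hs), ← Nat.mul_factorial_pred (by omega : n ≠ 0),
    ← Nat.mul_factorial_pred hr]
  have e : (s.factorial : ℚ) ^ r = (s.factorial : ℚ) ^ (r - 1) * (s * (s - 1).factorial) := by
    obtain ⟨k, rfl⟩ := Nat.exists_eq_succ_of_ne_zero hr
    rw [Nat.succ_sub_one, pow_succ]
    congr 1
    rw [← Nat.mul_factorial_pred hs]
    push_cast
    rfl
  rw [e]
  have hn' : (n : ℚ) = r * s := by exact_mod_cast h1.symm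
  have f1 : ((s - 1).factorial : ℚ) ≠ 0 := by exact_mod_cast Nat.factorial_ne_zero _
  have f2 : ((r - 1).factorial : ℚ) ≠ 0 := by exact_mod_cast Nat.factorial_ne_zero _
  have f3 : ((s.factorial : ℚ) ^ (r - 1)) ≠ 0 :=
    pow_ne_zero _ (by exact_mod_cast Nat.factorial_ne_zero _)
  have f4 : (r : ℚ) ≠ 0 := by exact_mod_cast hr
  have f5 : (s : ℚ) ≠ 0 := by exact_mod_cast hs
  push_cast
  rw [hn']
  generalize (s.factorial : ℚ) ^ (r - 1) = z at *
  field_simp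
end
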